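/- Let A ∈ GL(n,ℂ) be generic, and let x, y be the unique upper unitriangular matrices such that x^{−1} A y is counter-diagonal. Then for j > i, the entries of y are given by y_{ij} = (−1)^{i+j} |A|_{{n−j+2,…,n},{1,…,j}∖{i}} / |A|_{{n−j+2,…,n},{1,…,j−1}}. -/

import Mathlib

/-- The minor `|A|_{I,J}` of a square matrix: the determinant of the submatrix of `A` with
rows indexed by `I` and columns indexed by `J`, both taken in increasing order.
(Junk value `0` if `I` and `J` do not have the same cardinality.) -/
noncomputable def minor {n : ℕ} (A : Matrix (Fin n) (Fin n) ℂ) (I J : Finset (Fin n)) : ℂ :=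
  if h : J.card = I.card then
    (A.submatrix (I.orderEmbOfFin rfl) (J.orderEmbOfFin h)).det
  else 0

/-- A matrix is generic if for every `k ∈ {1, …, n}` (here `k` is 0-based, `k ∈ {0, …, n-1}`)
the minor with rows `{k, …, n-1}` and columns `{0, …, n-1-k}` is nonzero. -/
def IsGeneric {n : ℕ} (A : Matrix (Fin n) (Fin n) ℂ) : Prop :=
  ∀ k : ℕ, k < n →
    minor A (Finset.univ.filter fun i : Fin n => k ≤ (i : ℕ))
      (Finset.univ.filter fun j : Fin n => (j : ℕ) < n - k) ≠ 0

/-- An upper triangular matrix with `1`'s on the diagonal. -/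
def IsUnitriangular {n : ℕ} (x : Matrix (Fin n) (Fin n) ℂ) : Prop :=
  (∀ i, x i i = 1) ∧ ∀ i j : Fin n, j < i → x i j = 0

/-- A matrix `q` is counter-diagonal if `q i j = 0` unless `i + j = n - 1`
(1-based: unless `j = n - i + 1`). -/
def IsCounterDiag {n : ℕ} (q : Matrix (Fin n) (Fin n) ℂ) : Prop :=
  ∀ i j : Fin n, (i : ℕ) + (j : ℕ) ≠ n - 1 → q i j = 0

/-- A matrix `L` is lower counter-triangular if `L i j = 0` whenever `i + j > n - 1`
(1-based: whenever `j > n - i + 1`). -/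
def IsLowerCounterTriangular {n : ℕ} (L : Matrix (Fin n) (Fin n) ℂ) : Prop :=
  ∀ i j : Fin n, n - 1 < (i : ℕ) + (j : ℕ) → L i j = 0

/-- A minor is the determinant of the submatrix along any strictly increasing enumerations of its
rows and columns. -/
theorem minor_eq_det_submatrix {n m : ℕ} (A : Matrix (Fin n) (Fin n) ℂ) {I J : Finset (Fin n)}
    {f g : Fin m → Fin n} (hf : StrictMono f) (hg : StrictMono g)
    (hI : ∀ r, r ∈ I ↔ ∃ k, f k = r) (hJ : ∀ c, c ∈ J ↔ ∃ k, g k = c) :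
    minor A I J = (A.submatrix f g).det := by
  have card_eq {K : Finset (Fin n)} {h : Fin m → Fin n} (hh : StrictMono h)
      (hK : ∀ r, r ∈ K ↔ ∃ k, h k = r) : K.card = m := by
    have : K = Finset.univ.map ⟨h, hh.injective⟩ := by ext; simp [hK]
    simp [this]
  have hIc := card_eq hf hI
  have hJc := card_eq hg hJ
  subst hIc
  rw [minor, dif_pos hJc,
    Finset.orderEmbOfFin_unique rfl (fun k => (hI _).2 ⟨k, rfl⟩) hf,
    Finset.orderEmbOfFin_unique hJc (fun k => (hJ _).2 ⟨k, rfl⟩) hg]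

/-- Cramer's rule for the kernel of an `m × (m + 1)` matrix. -/
theorem Matrix.mul_det_succAbove_of_mulVec_eq_zero {R : Type*} [CommRing R] {m : ℕ}
    (M : Matrix (Fin m) (Fin (m + 1)) R) (v : Fin (m + 1) → R) (hv : M.mulVec v = 0)
    (i j : Fin (m + 1)) :
    (-1) ^ (j : ℕ) * (M.submatrix id j.succAbove).det * v i =
      (-1) ^ (i : ℕ) * (M.submatrix id i.succAbove).det * v j := by
  let N : Matrix (Fin (m + 1)) (Fin (m + 1)) R := Matrix.of (Fin.cons (Pi.single j 1) M)
  have hN0 (c) : N 0 c = (Pi.single j 1 : Fin (m + 1) → R) c := rfl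
  have hNsub (c : Fin (m + 1)) :
      N.submatrix Fin.succ c.succAbove = M.submatrix id c.succAbove := rfl
  have hNv : N.mulVec v = Pi.single 0 (v j) := by
    funext r
    refine Fin.cases ?_ (fun r => ?_) r
    · simp [Matrix.mulVec, dotProduct, hN0, Pi.single_apply]
    · exact (congrFun hv r).trans (by simp)
  have hdet : N.det = (-1) ^ (j : ℕ) * (M.submatrix id j.succAbove).det := by
    rw [Matrix.det_succ_row_zero, Finset.sum_eq_single j]
    · simp [hN0, hNsub]
    · intro b _ hb
      simp [hN0, hb]
    · simp
  have key : N.det • v = N.adjugate.mulVec (Pi.single 0 (v j)) := by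
    rw [← hNv, Matrix.mulVec_mulVec, Matrix.adjugate_mul, Matrix.smul_mulVec, Matrix.one_mulVec]
  have := congrFun key i
  rw [Matrix.mulVec_single, Pi.smul_apply, hdet] at this
  simpa [Matrix.adjugate_fin_succ_eq_det_submatrix, hNsub] using this

theorem IsUnitriangular.det_eq_one {n : ℕ} {x : Matrix (Fin n) (Fin n) ℂ}
    (hx : IsUnitriangular x) : x.det = 1 := by
  rw [Matrix.det_of_isUpperTriangular fun i j h => hx.2 i j h]
  simp [hx.1]

/-- The product of an upper unitriangular and a counter-diagonal matrix vanishes below the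
counter-diagonal. -/
theorem IsUnitriangular.isLowerCounterTriangular_mul {n : ℕ} {x q : Matrix (Fin n) (Fin n) ℂ}
    (hx : IsUnitriangular x) (hq : IsCounterDiag q) : IsLowerCounterTriangular (x * q) := by
  intro r j hrj
  rw [Matrix.mul_apply]
  refine Finset.sum_eq_zero fun k _ => ?_
  by_cases hk : (k : ℕ) + j = n - 1
  · rw [hx.2 r k (by rw [Fin.lt_def]; omega), zero_mul]
  · rw [hq k j hk, mul_zero]

/-- if `A ∈ GL(n, ℂ)` is generic and `x, y` are the (unique) upper unitriangular
matrices with `x⁻¹ A y` counter-diagonal, then for `i < j` (0-based, corresponding to 1-based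
indices `i+1 < j+1`),
`y_{ij} = (−1)^{i+j} |A|_{{n−j+2,…,n},{1,…,j}∖{i}} / |A|_{{n−j+2,…,n},{1,…,j−1}}` (1-based
formula, written here in 0-based form; the sign exponent uses the 1-based indices). -/
theorem y_entries {n : ℕ} (A x y : Matrix (Fin n) (Fin n) ℂ)
    (hA : IsGeneric A) (hdet : A.det ≠ 0)
    (hx : IsUnitriangular x) (hy : IsUnitriangular y)
    (hq : IsCounterDiag (x⁻¹ * A * y)) :
    ∀ i j : Fin n, i < j →
      y i j =
        (-1 : ℂ) ^ (((i : ℕ) + 1) + ((j : ℕ) + 1)) *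
          minor A (Finset.univ.filter fun r : Fin n => n - (j : ℕ) ≤ (r : ℕ))
            (Finset.univ.filter fun c : Fin n => (c : ℕ) ≤ (j : ℕ) ∧ c ≠ i) /
          minor A (Finset.univ.filter fun r : Fin n => n - (j : ℕ) ≤ (r : ℕ))
            (Finset.univ.filter fun c : Fin n => (c : ℕ) < (j : ℕ)) := by
  intro i j hij
  have hij' : (i : ℕ) < j := hij
  have hAy : IsLowerCounterTriangular (A * y) := by
    have h := hx.isLowerCounterTriangular_mul hq
    rwa [Matrix.mul_assoc, Matrix.mul_nonsing_inv_cancel_left _ _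
      (by simp [hx.det_eq_one])] at h
  let f : Fin (j : ℕ) → Fin n := fun k => ⟨n - j + k, by omega⟩
  let g : Fin ((j : ℕ) + 1) → Fin n := Fin.castLE j.isLt
  have hf : StrictMono f := fun a b hab => by
    simp only [f, Fin.lt_def] at hab ⊢
    omega
  have hg : StrictMono g := Fin.strictMono_castLE _
  have hI (r : Fin n) : r ∈ Finset.univ.filter (fun r : Fin n => n - (j : ℕ) ≤ (r : ℕ)) ↔
      ∃ k, f k = r := by
    simp only [Finset.mem_filter, Finset.mem_univ, true_and]
    refine ⟨fun h => ⟨⟨r - (n - j), by omega⟩, Fin.ext ?_⟩, ?_⟩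
    · simp only [f]
      omega
    · rintro ⟨k, rfl⟩
      simp [f]
  have hJ (a : Fin ((j : ℕ) + 1)) (c : Fin n) :
      c ∈ Finset.univ.filter (fun c : Fin n => (c : ℕ) ≤ (j : ℕ) ∧ c ≠ g a) ↔
        ∃ k, (g ∘ a.succAbove) k = c := by
    simp only [Finset.mem_filter, Finset.mem_univ, true_and, Function.comp_apply]
    constructor
    · rintro ⟨hc, hca⟩
      obtain ⟨k, hk⟩ := Fin.exists_succAbove_eq
        (x := (⟨c, by omega⟩ : Fin ((j : ℕ) + 1))) (y := a)
        (fun h => hca (Fin.ext (by simp [g, ← h])))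
      exact ⟨k, by rw [hk]; rfl⟩
    · rintro ⟨k, rfl⟩
      exact ⟨Nat.le_of_lt_succ (a.succAbove k).isLt, fun h => a.succAbove_ne k (hg.injective h)⟩
  have hminor (a : Fin ((j : ℕ) + 1)) := minor_eq_det_submatrix A hf
    (hg.comp a.strictMono_succAbove) hI (hJ a)
  let i' : Fin ((j : ℕ) + 1) := ⟨i, by omega⟩
  have hcols : (Finset.univ.filter fun c : Fin n => (c : ℕ) < (j : ℕ)) =
      Finset.univ.filter fun c : Fin n => (c : ℕ) ≤ (j : ℕ) ∧ c ≠ j := by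
    refine Finset.filter_congr fun c _ => ?_
    simp only [ne_eq, Fin.ext_iff]
    omega
  have hne : minor A (Finset.univ.filter fun r : Fin n => n - (j : ℕ) ≤ (r : ℕ))
      (Finset.univ.filter fun c : Fin n => (c : ℕ) < (j : ℕ)) ≠ 0 := by
    have h := hA (n - j) (by omega)
    rwa [Nat.sub_sub_self j.isLt.le] at h
  have hker : (A.submatrix f g).mulVec (fun c => y (g c) j) = 0 := by
    funext r
    have h := hAy (f r) j (by simp only [f]; omega)
    rw [Matrix.mul_apply] at h
    rw [Pi.zero_apply, ← h]
    change ∑ c, A (f r) (g c) * y (g c) j = ∑ c, A (f r) c * y c j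
    refine Finset.sum_of_injOn g hg.injective.injOn (fun _ _ => by simp) (fun c _ hc => ?_)
      (fun _ _ => rfl)
    refine mul_eq_zero_of_right _ (hy.2 c j ?_)
    by_contra hcj
    exact hc ⟨⟨c, Nat.lt_succ_of_le (not_lt.1 hcj)⟩, by simp, rfl⟩
  have key := Matrix.mul_det_succAbove_of_mulVec_eq_zero _ _ hker i' (Fin.last _)
  have hlast : g (Fin.last _) = j := rfl
  have hi' : g i' = i := rfl
  simp only [Matrix.submatrix_submatrix, Function.comp_id, ← hminor, hlast, hi', hy.1,
    mul_one, Fin.val_last, i'] at key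
  rw [eq_div_iff hne, hcols]
  have hsq : (-1 : ℂ) ^ (j : ℕ) * (-1) ^ (j : ℕ) = 1 := by
    simp [← mul_pow]
  rw [pow_add, pow_succ, pow_succ]
  linear_combination (-1 : ℂ) ^ (j : ℕ) * key - y i j * minor A _ _ * hsq
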